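/- For every positive integer t, ∑_{k=0}^{t−1} U_k (1 − Θ_k) ≤ ⌈m⌉ ∑_{k=0}^{t−1} U_k Θ_k + ⌈(ln ᾱ − ln α_0)/ln γ_dec⌉; that is, the number of large unsuccessful iterations among the first t iterations is at most ⌈m⌉ times the number of large successful iterations plus the constant ⌈(ln ᾱ − ln α_0)/ln γ_dec⌉. -/

import Mathlib

open Finset

/-- The number of large unsuccessful iterations is at most ⌈m⌉ times the number of
large successful iterations, plus a constant. -/
theorem large_unsuccessful_bound
    (γinc γdec : ℝ) (hinc : 1 < γinc) (hdec0 : 0 < γdec) (hdec1 : γdec < 1)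
    (m : ℝ) (hm : m = -Real.log γinc / Real.log γdec)
    (Θ : ℕ → ℝ) (hΘ : ∀ k, Θ k = 0 ∨ Θ k = 1)
    (α : ℕ → ℝ) (α₀ : ℝ) (hα₀ : 0 < α₀) (hinit : α 0 = α₀)
    (hrec : ∀ k, α (k + 1) = if Θ k = 1 then γinc * α k else γdec * α k)
    (abar : ℝ) (habar0 : 0 < abar) (habar : abar ≤ α₀)
    (U : ℕ → ℝ)
    (hU : ∀ k, U k = if max (α k) (α (k + 1)) ≤ abar then 0 else 1)
    (t : ℕ) (ht : 0 < t) :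
    ∑ k ∈ Finset.range t, U k * (1 - Θ k)
      ≤ (⌈m⌉ : ℝ) * ∑ k ∈ Finset.range t, U k * Θ k
        + (⌈(Real.log abar - Real.log α₀) / Real.log γdec⌉ : ℝ) := by
  have hld : Real.log γdec < 0 := Real.log_neg hdec0 hdec1
  have hld0 : Real.log γdec ≠ 0 := hld.ne
  have hli : 0 < Real.log γinc := Real.log_pos hinc
  have hpos : ∀ k, 0 < α k := by
    intro k
    induction k with
    | zero => rw [hinit]; exact hα₀
    | succ k ih =>
      rw [hrec]
      split_ifs <;> positivity
  obtain ⟨x, hx⟩ : ∃ x : ℕ → ℝ, ∀ k, x k = (Real.log abar - Real.log (α k)) / Real.log γdec :=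
    ⟨_, fun _ => rfl⟩
  have hm0 : 0 < m := by
    rw [hm]; exact div_pos_of_neg_of_neg (by linarith) hld
  have hxs : ∀ k, Θ k = 1 → x (k + 1) = x k + m := by
    intro k h
    rw [hx, hx, hrec, if_pos h, Real.log_mul (by linarith) (hpos k).ne', hm]
    field_simp
    ring
  have hxf : ∀ k, Θ k = 0 → x (k + 1) = x k - 1 := by
    intro k h
    rw [hx, hx, hrec, if_neg (by rw [h]; norm_num), Real.log_mul hdec0.ne' (hpos k).ne']
    field_simp
    ring
  have hle : ∀ k, α k ≤ abar ↔ x k ≤ 0 := by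
    intro k
    rw [hx, div_le_iff_of_neg hld, zero_mul, sub_nonneg,
      Real.log_le_log_iff (hpos k) habar0]
  have key : ∀ n : ℕ, ∑ k ∈ Finset.range n, U k * (1 - Θ k) + ((max ⌈x n⌉ 0 : ℤ) : ℝ)
      ≤ (⌈m⌉ : ℝ) * ∑ k ∈ Finset.range n, U k * Θ k + (⌈x 0⌉ : ℝ) := by
    intro n
    induction n with
    | zero =>
      have h0 : 0 ≤ x 0 := by
        rw [hx, hinit]
        exact div_nonneg_of_nonpos (by linarith [Real.log_le_log habar0 habar]) hld.le
      have : 0 ≤ ⌈x 0⌉ := Int.ceil_nonneg h0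
      simp [max_eq_left this]
    | succ n ih =>
      rw [Finset.sum_range_succ, Finset.sum_range_succ, hU n]
      simp only [max_le_iff, hle]
      rcases hΘ n with h | h
      · have e := hxf n h
        have ec : ⌈x (n + 1)⌉ = ⌈x n⌉ - 1 := by rw [e, Int.ceil_sub_one]
        rw [h]
        by_cases hp : x n ≤ 0
        · rw [if_pos ⟨hp, by linarith⟩]
          have h1 : ⌈x n⌉ ≤ 0 := Int.ceil_le.2 (by simpa using hp)
          have h2 : max ⌈x (n + 1)⌉ 0 ≤ max ⌈x n⌉ 0 := by omega
          have h3 : ((max ⌈x (n + 1)⌉ 0 : ℤ) : ℝ) ≤ ((max ⌈x n⌉ 0 : ℤ) : ℝ) := by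
            exact_mod_cast h2
          linarith
        · rw [if_neg (fun h => hp h.1)]
          have h1 : 0 < ⌈x n⌉ := Int.ceil_pos.2 (not_le.1 hp)
          have h2 : max ⌈x (n + 1)⌉ 0 + 1 ≤ max ⌈x n⌉ 0 := by omega
          have h3 : ((max ⌈x (n + 1)⌉ 0 : ℤ) : ℝ) + 1 ≤ ((max ⌈x n⌉ 0 : ℤ) : ℝ) := by
            exact_mod_cast h2
          linarith
      · have e := hxs n h
        have ec : ⌈x (n + 1)⌉ ≤ ⌈x n⌉ + ⌈m⌉ := by rw [e]; exact Int.ceil_add_le _ _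
        have mc : 0 < ⌈m⌉ := Int.ceil_pos.2 hm0
        rw [h]
        by_cases hp : x (n + 1) ≤ 0
        · rw [if_pos ⟨by linarith, hp⟩]
          have h1 : ⌈x (n + 1)⌉ ≤ 0 := Int.ceil_le.2 (by simpa using hp)
          have h2 : max ⌈x (n + 1)⌉ 0 ≤ max ⌈x n⌉ 0 := by omega
          have h3 : ((max ⌈x (n + 1)⌉ 0 : ℤ) : ℝ) ≤ ((max ⌈x n⌉ 0 : ℤ) : ℝ) := by
            exact_mod_cast h2
          linarith
        · rw [if_neg (fun h => hp h.2)]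
          have h2 : max ⌈x (n + 1)⌉ 0 ≤ max ⌈x n⌉ 0 + ⌈m⌉ := by omega
          have h3 : ((max ⌈x (n + 1)⌉ 0 : ℤ) : ℝ) ≤ ((max ⌈x n⌉ 0 : ℤ) : ℝ) + (⌈m⌉ : ℝ) := by
            exact_mod_cast h2
          linarith
  have hk := key t
  have hn : (0 : ℝ) ≤ ((max ⌈x t⌉ 0 : ℤ) : ℝ) := by
    exact_mod_cast le_max_right _ _
  rw [hx 0, hinit] at hk
  linarith
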